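/- arXiv:0912.5072 — 5 statements merged into one kernel-verified Lean document; each statement's English description precedes it below -/
import Mathlib

section
/- Let ε = 1 and m = 3, and let d be a nonzero integer (positive or negative) with d ∣ pD. Then C′_d(ℚ₂) ≠ ∅ if and only if one of the following holds: (a) d ≡ 1 (mod 8); (b) pqD²/d ≡ 1 (mod 8); (c) d + pD ≡ 0 (mod 8); (d) d ≡ 3 (mod 4) and d + pD ≡ 4 (mod 8); (e) d ≡ 5 (mod 8) and d + pD ≡ 2 (mod 4). -/
/-- `CdPoints K m p q D d` says the curve `C_d` (with ε = 1), given by the homogeneous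
equation `d w² = d² u⁴ - 2(p+q)D d u² z² + 4^m D² z⁴`, has a point over `K`. -/
def CdPoints (K : Type) [Field K] (m : ℕ) (p q D d : ℤ) : Prop :=
  ∃ u z w : K, ¬(u = 0 ∧ z = 0) ∧
    (d : K) * w ^ 2 =
      (d : K) ^ 2 * u ^ 4 - 2 * ((p : K) + (q : K)) * (D : K) * (d : K) * u ^ 2 * z ^ 2
        + (4 : K) ^ m * (D : K) ^ 2 * z ^ 4

/-- `Cd'Points K p q D d` says the curve `C′_d` (with ε = 1), given by the homogeneous
equation `d w² = d² u⁴ + (p+q)D d u² z² + pq D² z⁴`, has a point over `K`. -/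
def Cd'Points (K : Type) [Field K] (p q D d : ℤ) : Prop :=
  ∃ u z w : K, ¬(u = 0 ∧ z = 0) ∧
    (d : K) * w ^ 2 =
      (d : K) ^ 2 * u ^ 4 + ((p : K) + (q : K)) * (D : K) * (d : K) * u ^ 2 * z ^ 2
        + (p : K) * (q : K) * (D : K) ^ 2 * z ^ 4

/-- An integer congruent to `1` modulo `8` is a square in `ℤ₂`. -/
theorem PadicInt.exists_sq_eq_intCast {n : ℤ} (hn : n ≡ 1 [ZMOD 8]) :
    ∃ r : ℤ_[2], r ^ 2 = n := by
  have h2 : ‖(2 : ℤ_[2])‖ = 2⁻¹ := by simpa using PadicInt.norm_p (p := 2)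
  have h8 : ‖((1 - n : ℤ) : ℤ_[2])‖ ≤ (2 : ℝ) ^ (-3 : ℤ) := by
    have := (PadicInt.norm_int_le_pow_iff_dvd (p := 2) (k := 1 - n) (n := 3)).2
      (by simpa using hn.dvd)
    simpa using this
  obtain ⟨r, hr, -⟩ := hensels_lemma (p := 2) (R := ℤ_[2])
    (F := (Polynomial.X ^ 2 - Polynomial.C (n : ℤ_[2]))) (a := 1) (by
      push_cast at h8
      simp only [Polynomial.coe_aeval_eq_eval, Polynomial.eval_sub, Polynomial.eval_pow,
        Polynomial.eval_X, Polynomial.eval_C, Polynomial.derivative_sub,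
        Polynomial.derivative_X_pow, Polynomial.derivative_C, one_pow]
      refine h8.trans_lt ?_
      simp [h2]
      norm_num)
  refine ⟨r, ?_⟩
  simpa [sub_eq_zero] using hr

theorem Padic.exists_sq_eq_intCast {n : ℤ} (hn : n ≡ 1 [ZMOD 8]) :
    ∃ r : ℚ_[2], r ^ 2 = n := by
  obtain ⟨r, hr⟩ := PadicInt.exists_sq_eq_intCast hn
  exact ⟨r, by exact_mod_cast congrArg (fun x : ℤ_[2] => (x : ℚ_[2])) hr⟩

theorem Int.sq_modEq_one_of_odd {a : ℤ} (ha : Odd a) : a ^ 2 ≡ 1 [ZMOD 8] := by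
  obtain ⟨k, rfl⟩ := ha
  obtain ⟨j, hj⟩ := Int.even_mul_succ_self k
  exact (Int.modEq_iff_dvd.2 ⟨j, by linear_combination 4 * hj⟩).symm

/-- Solvability modulo `128` of the equation of `C′_d`, with `q = p + 8` and `y = d w`, together
with `A = p D`. -/
theorem modEq_of_sq_modEq {A D d U Z Y : ℤ} (hA : Odd A) (hD : Odd D) (hd : Odd d)
    (hUZ : Odd U ∨ Odd Z)
    (h : Y ^ 2 ≡ d * (d * U ^ 2 + A * Z ^ 2) * (d * U ^ 2 + A * Z ^ 2 + 8 * D * Z ^ 2)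
      [ZMOD 128]) :
    d ≡ 1 [ZMOD 8] ∨ d + A ≡ 0 [ZMOD 8] ∨ (d ≡ 3 [ZMOD 4] ∧ d + A ≡ 4 [ZMOD 8]) ∨
      (d ≡ 5 [ZMOD 8] ∧ d + A ≡ 2 [ZMOD 4]) := by
  set s := d * U ^ 2 + A * Z ^ 2 with hs
  obtain ⟨c, hc⟩ := h.symm.dvd
  by_cases hs2 : Odd s
  · left
    have hY : Odd Y := by
      rw [← Int.odd_pow' (n := 2) two_ne_zero]
      have : Y ^ 2 = d * s * (s + 2 * (4 * D * Z ^ 2)) + 2 * (64 * c) := by linarith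
      rw [this]
      exact ((hd.mul hs2).mul (hs2.add_even (even_two_mul _))).add_even (even_two_mul _)
    obtain ⟨x, hx⟩ := (Int.sq_modEq_one_of_odd hY).symm.dvd
    obtain ⟨t, ht⟩ := (Int.sq_modEq_one_of_odd hs2).symm.dvd
    refine (Int.modEq_iff_dvd.2 ⟨x - 16 * c - d * t - d * s * D * Z ^ 2, ?_⟩).symm
    linear_combination -hc + hx - d * ht
  · have hU : Odd U := by
      by_contra hU
      have hZ := hUZ.resolve_left hU
      rw [Int.not_odd_iff_even] at hU
      exact hs2 (((hU.pow_of_ne_zero two_ne_zero).mul_left d).add_odd (hA.mul hZ.pow))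
    have hZ : Odd Z := by
      by_contra hZ
      rw [Int.not_odd_iff_even] at hZ
      exact hs2 ((hd.mul hU.pow).add_even ((hZ.pow_of_ne_zero two_ne_zero).mul_left A))
    obtain ⟨a, ha⟩ := (Int.sq_modEq_one_of_odd hU).symm.dvd
    obtain ⟨b, hb⟩ := (Int.sq_modEq_one_of_odd hZ).symm.dvd
    have hsum : s = d + A + 8 * (d * a + A * b) := by
      rw [hs]; linear_combination d * ha + A * hb
    generalize d * a + A * b = f at hsum
    rw [Int.not_odd_iff_even] at hs2
    obtain ⟨k, hk⟩ := hs2.two_dvd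
    have hE : Odd (D * Z ^ 2) := hD.mul hZ.pow
    have hc' : Y ^ 2 = d * s * (s + 8 * (D * Z ^ 2)) + 128 * c := by linarith
    generalize D * Z ^ 2 = E at hE hc'
    have hY2 : Even Y := by
      rw [← Int.even_pow' (n := 2) two_ne_zero, hc', hk]
      exact ⟨d * k * (2 * k + 8 * E) + 64 * c, by ring⟩
    obtain ⟨y, rfl⟩ := hY2.two_dvd
    have hy : y ^ 2 = d * k * (k + 4 * E) + 32 * c := by
      rw [hk] at hc'; linarith
    by_cases hkodd : Odd k
    · have hyodd : Odd y := by
        rw [← Int.odd_pow' (n := 2) two_ne_zero, hy,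
          show d * k * (k + 4 * E) + 32 * c = d * k * k + 2 * (2 * d * k * E + 16 * c) by ring]
        exact ((hd.mul hkodd).mul hkodd).add_even (even_two_mul _)
      right; right; right
      refine ⟨?_, ?_⟩
      · obtain ⟨x, hx⟩ := (Int.sq_modEq_one_of_odd hyodd).symm.dvd
        obtain ⟨t, ht⟩ := (Int.sq_modEq_one_of_odd hkodd).symm.dvd
        obtain ⟨r, hr⟩ := (hd.mul hkodd).mul hE
        have : 5 ≡ d [ZMOD 8] := Int.modEq_iff_dvd.2 ⟨x - 4 * c - d * t - r - 1, by
          linear_combination -hy + hx - d * ht - 4 * hr⟩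
        exact this.symm
      · obtain ⟨r, hr⟩ := hkodd
        unfold Int.ModEq; omega
    · rw [Int.not_odd_iff_even] at hkodd
      obtain ⟨l, rfl⟩ := hkodd.two_dvd
      by_cases hl : Odd l
      · have hyeven : Even y := by
          rw [← Int.even_pow' (n := 2) two_ne_zero, hy]
          exact ⟨d * l * (2 * l + 4 * E) + 16 * c, by ring⟩
        obtain ⟨v, rfl⟩ := hyeven.two_dvd
        have hv : v ^ 2 = d * l * (l + 2 * E) + 8 * c := by linarith
        have hvodd : Odd v := by
          rw [← Int.odd_pow' (n := 2) two_ne_zero, hv,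
            show d * l * (l + 2 * E) + 8 * c = d * l * l + 2 * (d * l * E + 4 * c) by ring]
          exact ((hd.mul hl).mul hl).add_even (even_two_mul _)
        right; right; left
        obtain ⟨x, hx⟩ := (Int.sq_modEq_one_of_odd hvodd).symm.dvd
        obtain ⟨t, ht⟩ := (Int.sq_modEq_one_of_odd hl).symm.dvd
        obtain ⟨r, hr⟩ := (hd.mul hl).mul hE
        obtain ⟨w, hw⟩ := hl
        refine ⟨?_, by unfold Int.ModEq; omega⟩
        have : 3 ≡ d [ZMOD 4] := Int.modEq_iff_dvd.2 ⟨2 * x - 2 * c - 2 * d * t - r - 1, by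
          linear_combination -hv + hx - d * ht - 2 * hr⟩
        exact this.symm
      · rw [Int.not_odd_iff_even] at hl
        obtain ⟨r, rfl⟩ := hl.two_dvd
        right; left
        unfold Int.ModEq; omega

theorem PadicInt.modEq_of_sq_eq {A D d : ℤ} (hA : Odd A) (hD : Odd D) (hd : Odd d)
    {u z y : ℤ_[2]} (huz : u = 1 ∨ z = 1)
    (h : y ^ 2 = d * (d * u ^ 2 + A * z ^ 2) * (d * u ^ 2 + A * z ^ 2 + 8 * D * z ^ 2)) :
    d ≡ 1 [ZMOD 8] ∨ d + A ≡ 0 [ZMOD 8] ∨ (d ≡ 3 [ZMOD 4] ∧ d + A ≡ 4 [ZMOD 8]) ∨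
      (d ≡ 5 [ZMOD 8] ∧ d + A ≡ 2 [ZMOD 4]) := by
  let φ : ℤ_[2] →+* ZMod (2 ^ 7) := PadicInt.toZModPow 7
  obtain ⟨U, hU⟩ := ZMod.intCast_surjective (φ u)
  obtain ⟨Z, hZ⟩ := ZMod.intCast_surjective (φ z)
  obtain ⟨Y, hY⟩ := ZMod.intCast_surjective (φ y)
  have hodd : ∀ {V : ℤ}, (V : ZMod (2 ^ 7)) = 1 → Odd V := by
    intro V hV
    have h1 : (V : ZMod (2 ^ 7)) = (1 : ℤ) := by rw [hV, Int.cast_one]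
    rw [ZMod.intCast_eq_intCast_iff] at h1
    obtain ⟨k, hk⟩ := h1.symm.dvd
    exact ⟨64 * k, by push_cast at hk; linarith⟩
  refine modEq_of_sq_modEq hA hD hd (U := U) (Z := Z) (Y := Y) ?_ ?_
  · exact huz.imp (fun hu => hodd (by rw [hU, hu, map_one]))
      (fun hz => hodd (by rw [hZ, hz, map_one]))
  · have h' := congrArg φ h
    simp only [map_mul, map_add, map_pow, map_intCast, map_ofNat, ← hU, ← hZ, ← hY] at h'
    exact (ZMod.intCast_eq_intCast_iff _ _ _).1 (by push_cast; exact h')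

/-- A point of `C′_d` over `ℚ₂` can be scaled to integral coordinates with `u = 1` or `z = 1`. -/
theorem Padic.modEq_of_sq_eq {A D d : ℤ} (hA : Odd A) (hD : Odd D) (hd : Odd d)
    {u z y : ℚ_[2]} (huz : ¬(u = 0 ∧ z = 0))
    (h : y ^ 2 = d * (d * u ^ 2 + A * z ^ 2) * (d * u ^ 2 + A * z ^ 2 + 8 * D * z ^ 2)) :
    d ≡ 1 [ZMOD 8] ∨ d + A ≡ 0 [ZMOD 8] ∨ (d ≡ 3 [ZMOD 4] ∧ d + A ≡ 4 [ZMOD 8]) ∨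
      (d ≡ 5 [ZMOD 8] ∧ d + A ≡ 2 [ZMOD 4]) := by
  have key : ∀ (u z : ℤ_[2]) (y : ℚ_[2]), (u = 1 ∨ z = 1) →
      y ^ 2 = d * (d * u ^ 2 + A * z ^ 2) * (d * u ^ 2 + A * z ^ 2 + 8 * D * z ^ 2) →
      d ≡ 1 [ZMOD 8] ∨ d + A ≡ 0 [ZMOD 8] ∨ (d ≡ 3 [ZMOD 4] ∧ d + A ≡ 4 [ZMOD 8]) ∨
        (d ≡ 5 [ZMOD 8] ∧ d + A ≡ 2 [ZMOD 4]) := by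
    intro u z y huz h
    have h1 : y ^ 2 = ((d * (d * u ^ 2 + A * z ^ 2) *
        (d * u ^ 2 + A * z ^ 2 + 8 * D * z ^ 2) : ℤ_[2]) : ℚ_[2]) := by
      rw [h]; push_cast; rfl
    have hy : ‖y‖ ≤ 1 := by
      have h2 : ‖y‖ ^ 2 ≤ 1 := by
        rw [← norm_pow, h1]
        exact PadicInt.norm_le_one _
      exact (pow_le_one_iff_of_nonneg (norm_nonneg _) two_ne_zero).1 h2
    refine PadicInt.modEq_of_sq_eq hA hD hd (y := ⟨y, hy⟩) huz ?_
    apply Subtype.ext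
    rw [← h1]
    rfl
  rcases le_or_gt ‖u‖ ‖z‖ with hle | hlt
  · have hz : z ≠ 0 := by
      rintro rfl
      exact huz ⟨norm_le_zero_iff.1 (by simpa using hle), rfl⟩
    have hn : ‖u / z‖ ≤ 1 := by
      rw [norm_div]; exact div_le_one_of_le₀ hle (norm_nonneg _)
    refine key ⟨u / z, hn⟩ 1 (y / z ^ 2) (Or.inr rfl) ?_
    simp only [PadicInt.coe_one]
    field_simp
    linear_combination h
  · have hu : u ≠ 0 := by
      rintro rfl
      exact absurd hlt (by simp)
    have hn : ‖z / u‖ ≤ 1 := by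
      rw [norm_div]; exact div_le_one_of_le₀ hlt.le (norm_nonneg _)
    refine key 1 ⟨z / u, hn⟩ (y / u ^ 2) (Or.inl rfl) ?_
    simp only [PadicInt.coe_one]
    field_simp
    linear_combination h

/-- If `d s (s + 8 D) = c² n` with `s = d u² + p D` for some integer `u` and `n ≡ 1` modulo `8`, then
`C′_d(ℚ₂) ≠ ∅`. -/
theorem cd'Points_of_modEq {p q D d u c n : ℤ} (hq : q = p + 8) (hd : d ≠ 0)
    (hn : n ≡ 1 [ZMOD 8])
    (h : d * (d * u ^ 2 + p * D) * (d * u ^ 2 + p * D + 8 * D) = c ^ 2 * n) :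
    Cd'Points ℚ_[2] p q D d := by
  obtain ⟨r, hr⟩ := Padic.exists_sq_eq_intCast hn
  have hd' : (d : ℚ_[2]) ≠ 0 := Int.cast_ne_zero.2 hd
  have h' := congrArg (Int.cast : ℤ → ℚ_[2]) h
  push_cast at h'
  refine ⟨u, 1, c * r / d, by simp, ?_⟩
  subst hq
  push_cast
  field_simp
  rw [hr]
  linear_combination -h'

theorem stmt14
    (m : ℕ) (hm : 1 ≤ m)
    (p q : ℕ) (hp : p.Prime) (hq : q.Prime) (hpodd : Odd p) (hqodd : Odd q)
    (hpq : (q : ℤ) - (p : ℤ) = 2 ^ m)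
    (D : ℤ) (hD0 : 0 < D) (hDsf : Squarefree D) (hDodd : Odd D)
    (hpD : ¬((p : ℤ) ∣ D)) (hqD : ¬((q : ℤ) ∣ D))
    (hm3 : m = 3)
    (d : ℤ) (hd0 : d ≠ 0) (hdD : d ∣ (p : ℤ) * D) :
    Cd'Points ℚ_[2] (p : ℤ) (q : ℤ) D d ↔
      (d ≡ 1 [ZMOD 8] ∨
        (p : ℤ) * (q : ℤ) * D ^ 2 / d ≡ 1 [ZMOD 8] ∨
        d + (p : ℤ) * D ≡ 0 [ZMOD 8] ∨
        (d ≡ 3 [ZMOD 4] ∧ d + (p : ℤ) * D ≡ 4 [ZMOD 8]) ∨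
        (d ≡ 5 [ZMOD 8] ∧ d + (p : ℤ) * D ≡ 2 [ZMOD 4])) := by
  subst hm3
  have hpodd' : Odd (p : ℤ) := by exact_mod_cast hpodd
  have hq8 : (q : ℤ) = p + 8 := by linarith
  have hA : Odd ((p : ℤ) * D) := hpodd'.mul hDodd
  have hd : Odd d := by
    obtain ⟨e, he⟩ := hdD
    rw [he] at hA
    exact (Int.odd_mul.1 hA).1
  have hd' : (d : ℚ_[2]) ≠ 0 := Int.cast_ne_zero.2 hd0
  have hdsq := Int.sq_modEq_one_of_odd hd
  constructor
  · rintro ⟨u, z, w, huz, h⟩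
    have := Padic.modEq_of_sq_eq hA hDodd hd (y := d * w) huz (by
      rw [hq8] at h
      push_cast at h ⊢
      linear_combination (d : ℚ_[2]) * h)
    tauto
  · have hone : d ≡ 1 [ZMOD 8] → Cd'Points ℚ_[2] (p : ℤ) (q : ℤ) D d := by
      intro h
      obtain ⟨r, hr⟩ := Padic.exists_sq_eq_intCast h
      exact ⟨1, 0, r, by simp, by rw [hr]; ring⟩
    rintro (h | h | h | ⟨h, h'⟩ | ⟨h, h'⟩)
    · exact hone h
    · apply hone
      obtain ⟨e, he⟩ := hdD
      have hdiv : (p : ℤ) * q * D ^ 2 = d * (e * q * D) := by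
        linear_combination (q : ℤ) * D * he
      rw [hdiv, Int.mul_ediv_cancel_left _ hd0] at h
      have h1 := h.mul_left d
      have h2 : d * (e * q * D) ≡ (p * D) ^ 2 [ZMOD 8] := by
        rw [← hdiv, hq8]
        exact Int.modEq_iff_dvd.2 ⟨-(p * D ^ 2), by ring⟩
      have h3 := h2.trans (Int.sq_modEq_one_of_odd hA)
      simpa using h1.symm.trans h3
    · have hn : -(p * D * d) ≡ 1 [ZMOD 8] := by
        have h1 := h.mul_left d
        refine Int.ModEq.trans ?_ hdsq
        obtain ⟨k, hk⟩ := h1.dvd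
        exact Int.modEq_iff_dvd.2 ⟨-k, by linear_combination -hk⟩
      obtain ⟨r, hr⟩ := Padic.exists_sq_eq_intCast hn
      refine ⟨r, d, 0, fun h0 => hd' h0.2, ?_⟩
      rw [show r ^ 4 = (r ^ 2) ^ 2 by ring, hr]
      push_cast
      ring
    · obtain ⟨l, hl⟩ := h'.symm.dvd
      obtain ⟨D', rfl⟩ := hDodd
      have hs : d + p * (2 * D' + 1) = 4 * (2 * l + 1) := by linarith
      have hpoint : ∀ u l' : ℤ, d * u ^ 2 + p * (2 * D' + 1) = 4 * (2 * l' + 1) →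
          d * (2 * l' + 1) * (2 * l' + 1 + 2 * (2 * D' + 1)) ≡ 1 [ZMOD 8] →
          Cd'Points ℚ_[2] (p : ℤ) (q : ℤ) (2 * D' + 1) d := fun u l' hu hn =>
        cd'Points_of_modEq hq8 hd0 (u := u) (c := 4) hn (by rw [hu]; ring)
      have hmod : ∀ l' : ℤ, d * (2 * l' + 1) * (2 * l' + 1 + 2 * (2 * D' + 1)) ≡
          d * (3 + 4 * (l' + D')) [ZMOD 8] := by
        intro l'
        obtain ⟨k, hk⟩ := (Int.sq_modEq_one_of_odd (odd_two_mul_add_one l')).symm.dvd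
        exact Int.modEq_iff_dvd.2 ⟨-d * k - d * l' * D', by linear_combination -d * hk⟩
      obtain ⟨e, he⟩ : ∃ e, d = 4 * e + 3 := ⟨d / 4, by unfold Int.ModEq at h; omega⟩
      -- the parity of `l` can be switched by passing from `u = 1` to `u = 3`
      have hfin : ∀ l' : ℤ, Even (l' + D' + e) →
          d * (3 + 4 * (l' + D')) ≡ 1 [ZMOD 8] := by
        rintro l' ⟨g, hg⟩
        refine (Int.modEq_iff_dvd.2
          ⟨1 + 3 * g + 2 * e * (l' + D'), ?_⟩).symm
        rw [he]
        linear_combination 12 * hg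
      rcases Int.even_or_odd (l + D' + e) with hev | hodd
      · exact hpoint 1 l (by linarith) ((hmod l).trans (hfin l hev))
      · refine hpoint 3 (l + d) (by linarith) ((hmod _).trans (hfin _ ?_))
        have := hodd.add_odd hd
        rwa [show l + d + D' + e = l + D' + e + d by ring]
    · obtain ⟨l, hl⟩ := h'.symm.dvd
      have hs : d + p * D = 2 * (2 * l + 1) := by linarith
      obtain ⟨k, hk⟩ := (Int.sq_modEq_one_of_odd (odd_two_mul_add_one l)).symm.dvd
      obtain ⟨e, he⟩ := h.symm.dvd
      obtain ⟨g, hg⟩ := (odd_two_mul_add_one l).mul hDodd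
      refine cd'Points_of_modEq hq8 hd0 (u := 1) (c := 2)
        (n := d * (2 * l + 1) * (2 * l + 1 + 4 * D)) ?_ ?_
      · refine (Int.modEq_iff_dvd.2 ⟨d * k + d * g + 3 + 5 * e, ?_⟩).symm
        linear_combination d * hk + 4 * d * hg + 5 * he
      · rw [one_pow, mul_one, hs]; ring
end

section
/- Let ε = 1 and m = 4, and let d be a nonzero integer (positive or negative) with d ∣ pD. Then C′_d(ℚ₂) ≠ ∅ if and only if one of the following holds: (a) d ≡ 1 (mod 8); (b) pqD²/d ≡ 1 (mod 8); (c) d + pD ≡ 0 (mod 8); (d) d ≡ 1 (mod 8) and d + pD ≡ 2 (mod 4); (e) d ≡ 5 (mod 8) and d + pD ≡ 4 (mod 8). -/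
/-- An integer congruent to `1` modulo `8` is a square in `ℚ_[2]`. -/
theorem exists_padic_sq_eq_of_one_mod_eight {a : ℤ} (ha : a ≡ 1 [ZMOD 8]) :
    ∃ x : ℚ_[2], x ^ 2 = (a : ℚ_[2]) := by
  obtain ⟨k, hk⟩ := ha.symm.dvd
  obtain rfl : a = 1 + 8 * k := by linarith
  have h2 : ‖(2 : ℤ_[2])‖ = 2⁻¹ := by simpa using PadicInt.norm_p (p := 2)
  have hk1 : ‖(k : ℤ_[2])‖ ≤ 1 := PadicInt.norm_le_one _
  let F : Polynomial ℤ_[2] := Polynomial.X ^ 2 - Polynomial.C ((1 + 8 * k : ℤ) : ℤ_[2])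
  have hF : F.aeval (1 : ℤ_[2]) = -(2 ^ 3 * (k : ℤ_[2])) := by
    simp only [F, map_sub, map_pow, Polynomial.aeval_X, Polynomial.coe_aeval_eq_eval,
      Polynomial.eval_C]
    push_cast
    ring
  have hF' : F.derivative.aeval (1 : ℤ_[2]) = 2 := by
    simp [F]
    norm_num
  obtain ⟨x, hx, -⟩ := hensels_lemma (F := F) (a := (1 : ℤ_[2])) (by
    rw [hF, hF', norm_neg, norm_mul, norm_pow, h2]
    nlinarith)
  have hx' : x ^ 2 = ((1 + 8 * k : ℤ) : ℤ_[2]) := by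
    simpa [F, sub_eq_zero] using hx
  exact ⟨x, by exact_mod_cast congrArg (fun y : ℤ_[2] => (y : ℚ_[2])) hx'⟩

theorem PadicInt.eight_dvd_of_toZModPow_eq_zero {x : ℤ_[2]}
    (hx : PadicInt.toZModPow (p := 2) 3 x = 0) : ∃ t : ℤ_[2], x = 8 * t := by
  have h : x ∈ RingHom.ker (PadicInt.toZModPow (p := 2) 3) := hx
  rw [PadicInt.ker_toZModPow, Ideal.mem_span_singleton] at h
  obtain ⟨t, ht⟩ := h
  exact ⟨t, by rw [ht]; norm_num⟩

theorem Odd.intCast_zmod_eight_mul_self {a : ℤ} (ha : Odd a) :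
    (a : ZMod (2 ^ 3)) * a = 1 := by
  obtain ⟨k, rfl⟩ := ha
  push_cast
  generalize (k : ZMod (2 ^ 3)) = x
  revert x
  decide

theorem PadicInt.coe_ofNat {p : ℕ} [Fact p.Prime] (n : ℕ) [n.AtLeastTwo] :
    ((ofNat(n) : ℤ_[p]) : ℚ_[p]) = ofNat(n) :=
  map_ofNat (PadicInt.Coe.ringHom (p := p)) n

/-- If `t` is a 2-adic unit and `d w² = t` with `d` odd, then `d` and `t` agree modulo `8`. -/
theorem intCast_eq_toZModPow_of_mul_sq_eq {d : ℤ} (hd : Odd d) {w : ℚ_[2]} {t : ℤ_[2]}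
    (ht : PadicInt.toZModPow (p := 2) 3 t * PadicInt.toZModPow 3 t = 1)
    (h : (d : ℚ_[2]) * w ^ 2 = t) :
    (d : ZMod (2 ^ 3)) = PadicInt.toZModPow (p := 2) 3 t := by
  have hdn : ‖(d : ℚ_[2])‖ = 1 := by
    refine le_antisymm (Padic.norm_int_le_one d) (not_lt.mp fun hlt => ?_)
    have := (Padic.norm_intCast_lt_one_iff (p := 2) (k := d)).mp hlt
    obtain ⟨k, rfl⟩ := hd
    norm_num at this
  have hw : ‖w‖ ≤ 1 := by
    have h1 : ‖(d : ℚ_[2]) * w ^ 2‖ ≤ 1 := by rw [h]; exact t.2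
    rw [norm_mul, norm_pow, hdn, one_mul] at h1
    exact (pow_le_one_iff_of_nonneg (norm_nonneg w) two_ne_zero).mp h1
  obtain ⟨w, rfl⟩ : ∃ v : ℤ_[2], (v : ℚ_[2]) = w := ⟨⟨w, hw⟩, rfl⟩
  have h' : (d : ℤ_[2]) * w ^ 2 = t := by
    apply Subtype.ext
    push_cast
    exact h
  have h2 := congrArg (PadicInt.toZModPow (p := 2) 3) h'
  rw [map_mul, map_pow, map_intCast] at h2
  have key : ∀ a b c : ZMod (2 ^ 3), a * a = 1 → c * c = 1 → a * b ^ 2 = c → a = c := by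
    decide
  exact key _ _ _ hd.intCast_zmod_eight_mul_self ht h2

theorem exists_eq_two_mul_of_norm_lt_one {y : ℚ_[2]} (hy : ‖y‖ < 1) : ∃ t : ℤ_[2], y = 2 * t := by
  obtain ⟨y, rfl⟩ : ∃ v : ℤ_[2], (v : ℚ_[2]) = y := ⟨⟨y, hy.le⟩, rfl⟩
  obtain ⟨t, ht⟩ := PadicInt.norm_lt_one_iff_dvd y |>.mp (by simpa using hy)
  exact ⟨t, by rw [ht]; push_cast; rfl⟩

theorem intModEq_eight_of_zmod_eq {a b : ℤ} (h : (a : ZMod (2 ^ 3)) = (b : ZMod (2 ^ 3))) :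
    a ≡ b [ZMOD 8] := by
  simpa using (ZMod.intCast_eq_intCast_iff a b (2 ^ 3)).mp h


/-- If `d w²` equals a product of two quadratic forms with odd coefficients evaluated at
`(1, y)` with `‖y‖ < 1`, then modulo `8` only the constant coefficients matter. -/
theorem modEq_of_mul_sq_eq_of_norm_lt_one {a b c e d : ℤ} (hd : Odd d) (ha : Odd a)
    (hb : Odd b) (hc : Odd c) (he : Odd e) {w y : ℚ_[2]} (hy : ‖y‖ < 1)
    (h : (d : ℚ_[2]) * w ^ 2 = (a + b * y ^ 2) * (c + e * y ^ 2)) :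
    d ≡ a * c [ZMOD 8] := by
  obtain ⟨t, rfl⟩ := exists_eq_two_mul_of_norm_lt_one hy
  have key : ∀ a b c e s : ZMod (2 ^ 3), a * a = 1 → b * b = 1 → c * c = 1 → e * e = 1 →
      (a + b * (2 * s) ^ 2) * (c + e * (2 * s) ^ 2) = a * c := by
    decide
  have hφ : PadicInt.toZModPow (p := 2) 3
      ((a + b * (2 * t) ^ 2) * (c + e * (2 * t) ^ 2)) = a * c := by
    simp only [map_mul, map_add, map_pow, map_intCast, map_ofNat]
    exact key _ _ _ _ _ ha.intCast_zmod_eight_mul_self hb.intCast_zmod_eight_mul_self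
      hc.intCast_zmod_eight_mul_self he.intCast_zmod_eight_mul_self
  have hac : (a * c : ZMod (2 ^ 3)) * (a * c) = 1 := by
    rw [mul_mul_mul_comm, ha.intCast_zmod_eight_mul_self, hc.intCast_zmod_eight_mul_self, one_mul]
  have := intCast_eq_toZModPow_of_mul_sq_eq hd (w := w)
    (t := (a + b * (2 * t) ^ 2) * (c + e * (2 * t) ^ 2)) (by rw [hφ, hac])
    (by rw [h]; push_cast; rfl)
  rw [hφ] at this
  exact intModEq_eight_of_zmod_eq (by push_cast; exact this)

theorem PadicInt.exists_sq_eq_one_add_eight_mul {y : ℤ_[2]} (hy : ‖y‖ = 1) :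
    ∃ t : ℤ_[2], y ^ 2 = 1 + 8 * t := by
  obtain ⟨x, hx⟩ := PadicInt.isUnit_iff.mpr hy
  have key : ∀ a b : ZMod (2 ^ 3), a * b = 1 → a ^ 2 - 1 = 0 := by decide
  obtain ⟨t, ht⟩ := PadicInt.eight_dvd_of_toZModPow_eq_zero (x := y ^ 2 - 1) (by
    rw [map_sub, map_pow, map_one]
    refine key _ (PadicInt.toZModPow (p := 2) 3 (x⁻¹ : (ℤ_[2])ˣ)) ?_
    rw [← map_mul, ← hx, Units.mul_inv, map_one])
  exact ⟨t, by rw [← ht]; ring⟩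

/-- The condition on `d` given by a point of `d w² = (d + P y²) (d + (P + 16 D) y²)` with `y` a
unit. -/
theorem modEq_of_mul_sq_eq_of_norm_eq_one {d P D : ℤ} (hd : Odd d) (hP : Odd P) (hD : Odd D)
    {w y : ℚ_[2]} (hy : ‖y‖ = 1)
    (h : (d : ℚ_[2]) * w ^ 2 = (d + P * y ^ 2) * (d + (P + 16 * D) * y ^ 2)) :
    d ≡ 1 [ZMOD 8] ∨ d + P ≡ 0 [ZMOD 8] ∨ (d ≡ 5 [ZMOD 8] ∧ d + P ≡ 4 [ZMOD 8]) := by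
  obtain ⟨y, rfl⟩ : ∃ v : ℤ_[2], (v : ℚ_[2]) = y := ⟨⟨y, hy.le⟩, rfl⟩
  obtain ⟨t, ht⟩ := PadicInt.exists_sq_eq_one_add_eight_mul (by simpa using hy)
  have ht' : (y : ℚ_[2]) ^ 2 = 1 + 8 * t := by
    exact_mod_cast congrArg (fun x : ℤ_[2] => (x : ℚ_[2])) ht
  rw [ht'] at h
  have hcases : d + P ≡ 0 [ZMOD 8] ∨ (∃ k, Odd k ∧ d + P = 2 * k) ∨
      ∃ k, Odd k ∧ d + P = 4 * k := by
    obtain ⟨j, hj⟩ := hd.add_odd hP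
    rcases Int.even_or_odd j with ⟨i, rfl⟩ | hj'
    · rcases Int.even_or_odd i with ⟨l, rfl⟩ | hi
      · exact .inl (Int.modEq_zero_iff_dvd.mpr ⟨l, by linarith⟩)
      · exact .inr (.inr ⟨i, hi, by linarith⟩)
    · exact .inr (.inl ⟨j, hj', by linarith⟩)
  rcases hcases with h0 | ⟨k, hk, hk'⟩ | ⟨k, hk, hk'⟩
  · exact .inr (.inl h0)
  · left
    obtain rfl : P = 2 * k - d := by linarith
    have key : ∀ k P s D : ZMod (2 ^ 3), k * k = 1 →
        (k + 4 * P * s) * (k + 4 * P * s + 8 * D * (1 + 8 * s)) = 1 := by decide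
    have hφ : PadicInt.toZModPow (p := 2) 3
        ((k + 4 * (2 * k - d : ℤ) * t) *
          (k + 4 * (2 * k - d : ℤ) * t + 8 * D * (1 + 8 * t))) = 1 := by
      simp only [map_mul, map_add, map_intCast, map_ofNat, map_one]
      exact key _ _ _ _ hk.intCast_zmod_eight_mul_self
    have := intCast_eq_toZModPow_of_mul_sq_eq hd (w := w / 2)
      (by rw [hφ, one_mul]) (by push_cast at h ⊢; simp only [PadicInt.coe_ofNat]; linear_combination h / 4)
    rw [hφ] at this
    exact intModEq_eight_of_zmod_eq (by push_cast; exact this)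
  · right; right
    obtain rfl : P = 4 * k - d := by linarith
    have key : ∀ k P s D : ZMod (2 ^ 3), k * k = 1 → D * D = 1 →
        (k + 2 * P * s) * (k + 2 * P * s + 4 * D * (1 + 8 * s)) = 5 := by decide
    have hφ : PadicInt.toZModPow (p := 2) 3
        ((k + 2 * (4 * k - d : ℤ) * t) *
          (k + 2 * (4 * k - d : ℤ) * t + 4 * D * (1 + 8 * t))) = 5 := by
      simp only [map_mul, map_add, map_intCast, map_ofNat, map_one]
      exact key _ _ _ _ hk.intCast_zmod_eight_mul_self hD.intCast_zmod_eight_mul_self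
    have := intCast_eq_toZModPow_of_mul_sq_eq hd (w := w / 4)
      (by rw [hφ]; decide) (by push_cast at h ⊢; simp only [PadicInt.coe_ofNat]; linear_combination h / 16)
    rw [hφ] at this
    refine ⟨intModEq_eight_of_zmod_eq (by push_cast; exact this), ?_⟩
    obtain ⟨j, rfl⟩ := hk
    exact Int.modEq_iff_dvd.mpr ⟨-j, by ring⟩

theorem stmt15
    (m : ℕ) (hm : 1 ≤ m)
    (p q : ℕ) (hp : p.Prime) (hq : q.Prime) (hpodd : Odd p) (hqodd : Odd q)
    (hpq : (q : ℤ) - (p : ℤ) = 2 ^ m)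
    (D : ℤ) (hD0 : 0 < D) (hDsf : Squarefree D) (hDodd : Odd D)
    (hpD : ¬((p : ℤ) ∣ D)) (hqD : ¬((q : ℤ) ∣ D))
    (hm4 : m = 4)
    (d : ℤ) (hd0 : d ≠ 0) (hdD : d ∣ (p : ℤ) * D) :
    Cd'Points ℚ_[2] (p : ℤ) (q : ℤ) D d ↔
      (d ≡ 1 [ZMOD 8] ∨
        (p : ℤ) * (q : ℤ) * D ^ 2 / d ≡ 1 [ZMOD 8] ∨
        d + (p : ℤ) * D ≡ 0 [ZMOD 8] ∨
        (d ≡ 1 [ZMOD 8] ∧ d + (p : ℤ) * D ≡ 2 [ZMOD 4]) ∨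
        (d ≡ 5 [ZMOD 8] ∧ d + (p : ℤ) * D ≡ 4 [ZMOD 8])) := by
  subst hm4
  have hpZ : Odd (p : ℤ) := by exact_mod_cast hpodd
  have hqZ : Odd (q : ℤ) := by exact_mod_cast hqodd
  have hP : Odd ((p : ℤ) * D) := hpZ.mul hDodd
  have hQ : Odd ((q : ℤ) * D) := hqZ.mul hDodd
  have hd : Odd d := by
    obtain ⟨c, hc⟩ := hdD
    exact Int.Odd.of_mul_left (hc ▸ hP)
  have hqp : (q : ℤ) = p + 16 := by linarith
  have hqK : ((q : ℤ) : ℚ_[2]) = (p : ℤ) + 16 := by rw [hqp]; push_cast; ring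
  have hdK : (d : ℚ_[2]) ≠ 0 := by exact_mod_cast hd0
  obtain ⟨c, hc⟩ : d ∣ (p : ℤ) * q * D ^ 2 :=
    hdD.trans ⟨q * D, by ring⟩
  have hcdiv : (p : ℤ) * q * D ^ 2 / d = c := by rw [hc, Int.mul_ediv_cancel_left _ hd0]
  have hcK : ((p : ℤ) : ℚ_[2]) * (q : ℤ) * D ^ 2 = d * c := by exact_mod_cast hc
  have hdd : d * d ≡ 1 [ZMOD 8] :=
    intModEq_eight_of_zmod_eq (by push_cast; exact hd.intCast_zmod_eight_mul_self)
  rw [hcdiv]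
  constructor
  · rintro ⟨u, z, w, hne, h⟩
    rcases lt_trichotomy ‖z‖ ‖u‖ with hlt | heq | hlt
    · have hu : u ≠ 0 := norm_pos_iff.mp ((norm_nonneg z).trans_lt hlt)
      left
      refine (modEq_of_mul_sq_eq_of_norm_lt_one (w := w / u ^ 2) (y := z / u) hd hd hP hd hQ
        ?_ ?_).trans hdd
      · rwa [norm_div, div_lt_one (norm_pos_iff.mpr hu)]
      · push_cast at h ⊢
        field_simp
        linear_combination h
    · have hu : u ≠ 0 := by
        rintro rfl
        exact hne ⟨rfl, norm_eq_zero.mp (by rw [heq, norm_zero])⟩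
      have := modEq_of_mul_sq_eq_of_norm_eq_one (w := w / u ^ 2) (y := z / u) hd hP hDodd
        (by rw [norm_div, heq, div_self (norm_ne_zero_iff.mpr hu)]) (by
          rw [hqK] at h
          push_cast at h ⊢
          field_simp
          linear_combination h)
      tauto
    · have hz : z ≠ 0 := norm_pos_iff.mp ((norm_nonneg u).trans_lt hlt)
      have h1 := modEq_of_mul_sq_eq_of_norm_lt_one (w := w / z ^ 2) (y := u / z) hd hP hd hQ hd
        (by rwa [norm_div, div_lt_one (norm_pos_iff.mpr hz)]) (by
          push_cast at h ⊢
          field_simp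
          linear_combination h)
      right; left
      calc c = 1 * c := (one_mul c).symm
        _ ≡ d * d * c [ZMOD 8] := hdd.symm.mul_right c
        _ = d * (p * D * (q * D)) := by linear_combination -d * hc
        _ ≡ d * d [ZMOD 8] := h1.symm.mul_left d
        _ ≡ 1 [ZMOD 8] := hdd
  · have key1 : d ≡ 1 [ZMOD 8] → Cd'Points ℚ_[2] (p : ℤ) (q : ℤ) D d := fun h => by
      obtain ⟨x, hx⟩ := exists_padic_sq_eq_of_one_mod_eight h
      exact ⟨1, 0, x, by simp, by rw [hx]; ring⟩
    rintro (h | h | h | h | h)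
    · exact key1 h
    · obtain ⟨x, hx⟩ := exists_padic_sq_eq_of_one_mod_eight h
      exact ⟨0, 1, x, by simp, by rw [hx]; linear_combination -hcK⟩
    · obtain ⟨x, hx⟩ := exists_padic_sq_eq_of_one_mod_eight
        (a := 1 + 16 * d) (Int.modEq_iff_dvd.mpr ⟨-(2 * d), by ring⟩)
      obtain ⟨y, hy⟩ := exists_padic_sq_eq_of_one_mod_eight
        (a := -256 * D * d ^ 2 - q * D * d) (by
          obtain ⟨k, hk⟩ := h.dvd
          refine Int.ModEq.trans (Int.modEq_iff_dvd.mpr ⟨?_, ?_⟩) hdd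
          · exact 32 * D * d ^ 2 - k * d + 2 * D * d
          · rw [hqp]
            linear_combination -d * hk)
      push_cast at hx hy
      have hqK' : (q : ℚ_[2]) = p + 16 := by exact_mod_cast hqK
      refine ⟨y / d, 1, 64 * D * x, by simp, ?_⟩
      push_cast
      field_simp
      rw [hx, hy, hqK']
      ring
    · exact key1 h.1
    · obtain ⟨h5, h4⟩ := h
      obtain ⟨k, hk⟩ := h4.dvd
      obtain ⟨x, hx⟩ := exists_padic_sq_eq_of_one_mod_eight
        (a := d * ((1 - 2 * k) * (1 - 2 * k + 4 * D))) (by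
          have key : ∀ k D : ZMod (2 ^ 3), D * D = 1 →
              5 * ((1 - 2 * k) * (1 - 2 * k + 4 * D)) = 1 := by decide
          refine (h5.mul_right _).trans (intModEq_eight_of_zmod_eq ?_)
          push_cast
          exact key _ _ hDodd.intCast_zmod_eight_mul_self)
      refine ⟨1, 1, 4 * x / d, by simp, ?_⟩
      have hPK : ((p : ℤ) : ℚ_[2]) * D = 4 - 8 * k - d := by
        have : (p : ℤ) * D = 4 - 8 * k - d := by linarith
        exact_mod_cast congrArg (fun n : ℤ => (n : ℚ_[2])) this
      rw [hqK]
      field_simp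
      rw [hx]
      push_cast at hPK ⊢
      linear_combination (-d * (2 * d + p * D + 16 * D + 4 - 8 * k - d) : ℚ_[2]) * hPK
end

section
/- Let ε = 1 and m ≥ 5, and let d be a nonzero integer (positive or negative) with d ∣ pD. Then C′_d(ℚ₂) ≠ ∅ if and only if one of the following holds: (a) d ≡ 1 (mod 8); (b) pqD²/d ≡ 1 (mod 8); (c) d + pD ≡ 0 (mod 8). -/
theorem PadicInt.isSquare_one_add_eight_mul (x : ℤ_[2]) : IsSquare (1 + 8 * x) := by
  have h2 : ‖(2 : ℤ_[2])‖ = 2⁻¹ := by simpa using PadicInt.norm_p (p := 2)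
  have h8 : ‖(8 : ℤ_[2])‖ = 8⁻¹ := by
    rw [show (8 : ℤ_[2]) = 2 ^ 3 by norm_num, norm_pow, h2]; norm_num
  have hx : ‖8 * x‖ ≤ 8⁻¹ := by
    rw [norm_mul, h8]
    have := PadicInt.norm_le_one x
    linarith
  obtain ⟨y, hy, -⟩ := hensels_lemma (p := 2) (R := ℤ_[2])
    (F := (Polynomial.X ^ 2 - Polynomial.C (1 + 8 * x) : Polynomial ℤ_[2])) (a := 1) (by
      simp only [Polynomial.derivative_sub, Polynomial.derivative_X_pow, Polynomial.derivative_C,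
        map_sub, Polynomial.coe_aeval_eq_eval, Polynomial.eval_pow, Polynomial.eval_X,
        Polynomial.eval_C, Polynomial.eval_mul]
      simp only [one_pow, sub_add_cancel_left, norm_neg]
      norm_num [h2]
      rw [← norm_mul]
      linarith)
  refine ⟨y, ?_⟩
  simp at hy
  linear_combination -hy

theorem PadicInt.toZModPow_eq_zero_iff_dvd {p : ℕ} [Fact p.Prime] (n : ℕ) (x : ℤ_[p]) :
    PadicInt.toZModPow n x = 0 ↔ (p : ℤ_[p]) ^ n ∣ x := by
  rw [← RingHom.mem_ker, PadicInt.ker_toZModPow, Ideal.mem_span_singleton]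

theorem Int.four_mul_cast_zmod_eight_of_odd {d : ℤ} (hd : Odd d) : 4 * (d : ZMod (2 ^ 3)) = 4 := by
  obtain ⟨k, rfl⟩ := hd
  push_cast
  have : (8 : ZMod (2 ^ 3)) = 0 := by decide
  linear_combination k * this

theorem Int.modEq_one_of_isSquare_padic {d : ℤ} (hd : Odd d) (h : IsSquare (d : ℚ_[2])) :
    d ≡ 1 [ZMOD 8] := by
  obtain ⟨y, hy⟩ := h
  have hy1 : ‖y‖ ≤ 1 := by
    have h1 : ‖(d : ℚ_[2])‖ ≤ 1 := Padic.norm_int_le_one d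
    rw [hy, norm_mul] at h1
    nlinarith [norm_nonneg y]
  obtain ⟨x, rfl⟩ : ∃ x : ℤ_[2], (x : ℚ_[2]) = y := ⟨⟨y, hy1⟩, rfl⟩
  have hY : (d : ℤ_[2]) = x * x := Subtype.coe_injective (by simpa using hy)
  have := congrArg (PadicInt.toZModPow 3) hY
  rw [map_mul, map_intCast] at this
  have key : ∀ a b : ZMod (2 ^ 3), 4 * a = 4 → a = b * b → a = 1 := by decide
  have := key _ _ (Int.four_mul_cast_zmod_eight_of_odd hd) this
  exact (ZMod.intCast_eq_intCast_iff d 1 8).1 (by simpa using this)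

theorem Int.isSquare_padic_of_modEq_one {d : ℤ} (h : d ≡ 1 [ZMOD 8]) :
    IsSquare (d : ℚ_[2]) := by
  obtain ⟨k, hk⟩ := h.symm.dvd
  have := (PadicInt.isSquare_one_add_eight_mul k).map (PadicInt.Coe.ringHom (p := 2))
  rw [show d = 1 + 8 * k by linarith]
  rw [map_add, map_mul, map_one, map_ofNat, map_intCast] at this
  push_cast
  exact this

theorem PadicInt.dvd_four_of_toZModPow_ne_zero {A : ℤ_[2]}
    (hA : PadicInt.toZModPow 3 A ≠ 0) : A ∣ 4 := by
  have hA0 : A ≠ 0 := by rintro rfl; simp at hA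
  have hv : A.valuation < 3 := by
    by_contra! hv
    refine hA ((PadicInt.toZModPow_eq_zero_iff_dvd 3 A).2 ?_)
    rw [PadicInt.unitCoeff_spec hA0]
    exact Dvd.dvd.mul_left (pow_dvd_pow _ hv) _
  rw [PadicInt.unitCoeff_spec hA0, Units.mul_left_dvd,
    show (4 : ℤ_[2]) = ((2 : ℕ) : ℤ_[2]) ^ 2 by norm_num]
  exact pow_dvd_pow _ (by omega)

/-- If `d w² = A (A + 32 k z²)` over `ℚ₂` where `A = d u² + e z²`, with one of `u`, `z` equal to `1`
and the other integral, then either `d ≡ 1 (mod 8)` or `d + e` is divisible by `8`. -/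
theorem Int.modEq_of_primitive_padic_point {d e k : ℤ} (hd : Odd d) (he : Odd e) (u z : ℤ_[2])
    (huz : u = 1 ∨ z = 1) (w : ℚ_[2])
    (h : (d : ℚ_[2]) * w ^ 2 =
      (d * u ^ 2 + e * z ^ 2) * (d * u ^ 2 + e * z ^ 2 + 32 * k * z ^ 2)) :
    d ≡ 1 [ZMOD 8] ∨ d + e ≡ 0 [ZMOD 8] := by
  by_cases hA : PadicInt.toZModPow 3 (d * u ^ 2 + e * z ^ 2 : ℤ_[2]) = 0
  · right
    rw [map_add, map_mul, map_mul, map_pow, map_pow, map_intCast, map_intCast] at hA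
    have key : ∀ a b x : ZMod (2 ^ 3), 4 * a = 4 → 4 * b = 4 → a + b * x ^ 2 = 0 → a + b = 0 := by
      decide
    have hd4 := Int.four_mul_cast_zmod_eight_of_odd hd
    have he4 := Int.four_mul_cast_zmod_eight_of_odd he
    have : (d : ZMod (2 ^ 3)) + e = 0 := by
      rcases huz with rfl | rfl
      · exact key _ _ _ hd4 he4 (by simpa using hA)
      · rw [add_comm]
        exact key _ _ (PadicInt.toZModPow 3 u) he4 hd4 (by rw [add_comm]; simpa using hA)
    exact (ZMod.intCast_eq_intCast_iff (d + e) 0 8).1 (by simpa using this)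
  · left
    obtain ⟨c, hc⟩ := PadicInt.dvd_four_of_toZModPow_ne_zero hA
    obtain ⟨s, hs⟩ := PadicInt.isSquare_one_add_eight_mul (c * k * z ^ 2)
    have hA0 : (d * u ^ 2 + e * z ^ 2 : ℤ_[2]) ≠ 0 := by rintro h0; simp [h0] at hA
    have hs0 : s ≠ 0 := by
      rintro rfl
      have h0 := congrArg (PadicInt.toZModPow 3) hs
      rw [map_add, map_mul] at h0
      simp only [map_one, map_ofNat, mul_zero, map_zero] at h0
      revert h0
      generalize PadicInt.toZModPow 3 (c * (k : ℤ_[2]) * z ^ 2) = a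
      revert a
      decide
    have hAs : ((d * u ^ 2 + e * z ^ 2 : ℤ_[2]) * s : ℤ_[2]) ≠ 0 := mul_ne_zero hA0 hs0
    have hZ : (d * u ^ 2 + e * z ^ 2 : ℤ_[2]) * (d * u ^ 2 + e * z ^ 2 + 32 * k * z ^ 2) =
        ((d * u ^ 2 + e * z ^ 2 : ℤ_[2]) * s) ^ 2 := by
      linear_combination (d * u ^ 2 + e * z ^ 2 : ℤ_[2]) ^ 2 * hs +
        8 * k * z ^ 2 * (d * u ^ 2 + e * z ^ 2 : ℤ_[2]) * hc
    generalize hr : ((d * u ^ 2 + e * z ^ 2 : ℤ_[2]) * s : ℤ_[2]) = r at hZ hAs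
    have hr0 : (r : ℚ_[2]) ≠ 0 := by simpa using hAs
    have hQ : (d : ℚ_[2]) * w ^ 2 = (r : ℚ_[2]) ^ 2 := by
      have hcast := congrArg (PadicInt.Coe.ringHom (p := 2)) hZ
      simp only [map_mul, map_add, map_pow, map_intCast, map_ofNat] at hcast
      rw [h]
      exact hcast
    have hw : w ≠ 0 := by
      rintro rfl
      exact hr0 (by simpa using hQ.symm)
    refine Int.modEq_one_of_isSquare_padic hd ⟨r / w, ?_⟩
    field_simp
    linear_combination hQ

theorem Int.sq_modEq_one_of_odd_s16 {x : ℤ} (hx : Odd x) : x ^ 2 ≡ 1 [ZMOD 8] :=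
  (Int.modEq_iff_dvd.2 (Int.eight_dvd_sq_sub_one_of_odd hx)).symm

theorem stmt16
    (m : ℕ) (hm : 1 ≤ m)
    (p q : ℕ) (hp : p.Prime) (hq : q.Prime) (hpodd : Odd p) (hqodd : Odd q)
    (hpq : (q : ℤ) - (p : ℤ) = 2 ^ m)
    (D : ℤ) (hD0 : 0 < D) (hDsf : Squarefree D) (hDodd : Odd D)
    (hpD : ¬((p : ℤ) ∣ D)) (hqD : ¬((q : ℤ) ∣ D))
    (hm5 : 5 ≤ m)
    (d : ℤ) (hd0 : d ≠ 0) (hdD : d ∣ (p : ℤ) * D) :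
    Cd'Points ℚ_[2] (p : ℤ) (q : ℤ) D d ↔
      (d ≡ 1 [ZMOD 8] ∨
        (p : ℤ) * (q : ℤ) * D ^ 2 / d ≡ 1 [ZMOD 8] ∨
        d + (p : ℤ) * D ≡ 0 [ZMOD 8]) := by
  have hpZ : Odd (p : ℤ) := by exact_mod_cast hpodd
  have hpDodd : Odd ((p : ℤ) * D) := hpZ.mul hDodd
  have hd : Odd d := by
    obtain ⟨c, hc⟩ := hdD
    exact (Int.odd_mul.1 (hc ▸ hpDodd)).1
  obtain ⟨n, rfl⟩ := Nat.exists_eq_add_of_le hm5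
  have hq' : (q : ℤ) = p + 32 * 2 ^ n := by rw [pow_add] at hpq; linarith
  have hqQ : (q : ℚ_[2]) = p + 32 * 2 ^ n := by exact_mod_cast congrArg (Int.cast (R := ℚ_[2])) hq'
  have hdQ : (d : ℚ_[2]) ≠ 0 := by exact_mod_cast hd0
  constructor
  · rintro ⟨u, z, w, huz, h⟩
    have key : d ≡ 1 [ZMOD 8] ∨ d + (p : ℤ) * D ≡ 0 [ZMOD 8] := by
      rcases le_total ‖z‖ ‖u‖ with hle | hle
      · have hu : u ≠ 0 := by
          rintro rfl
          exact huz ⟨rfl, by simpa using hle⟩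
        have ht : ‖z / u‖ ≤ 1 := by
          rw [norm_div]; exact div_le_one_of_le₀ hle (norm_nonneg _)
        refine Int.modEq_of_primitive_padic_point (k := 2 ^ n * D) hd hpDodd 1 ⟨z / u, ht⟩
          (Or.inl rfl) (w / u ^ 2) ?_
        push_cast at h ⊢
        rw [hqQ] at h
        field_simp
        linear_combination h
      · have hz : z ≠ 0 := by
          rintro rfl
          exact huz ⟨by simpa using hle, rfl⟩
        have ht : ‖u / z‖ ≤ 1 := by
          rw [norm_div]; exact div_le_one_of_le₀ hle (norm_nonneg _)
        refine Int.modEq_of_primitive_padic_point (k := 2 ^ n * D) hd hpDodd ⟨u / z, ht⟩ 1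
          (Or.inr rfl) (w / z ^ 2) ?_
        push_cast at h ⊢
        rw [hqQ] at h
        field_simp
        linear_combination h
    tauto
  · have of_one : d ≡ 1 [ZMOD 8] → Cd'Points ℚ_[2] (p : ℤ) (q : ℤ) D d := by
      intro h
      obtain ⟨y, hy⟩ := Int.isSquare_padic_of_modEq_one h
      refine ⟨1, 0, y, by simp, ?_⟩
      rw [hy]; ring
    rintro (h | h | h)
    · exact of_one h
    · apply of_one
      have hdvd : d ∣ (p : ℤ) * q * D ^ 2 := hdD.trans ⟨q * D, by ring⟩
      have hmul := Int.mul_ediv_cancel' hdvd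
      have h1 : d ≡ (p : ℤ) * q * D ^ 2 [ZMOD 8] := by
        simpa [hmul] using (h.mul_left d).symm
      have h2 : ((p : ℤ) * D) ^ 2 ≡ 1 [ZMOD 8] := Int.sq_modEq_one_of_odd_s16 hpDodd
      refine h1.trans (Int.ModEq.trans ?_ h2)
      rw [hq', Int.modEq_iff_dvd]
      exact ⟨-(4 * 2 ^ n * p * D ^ 2), by ring⟩
    · have hsq : d * (-((p : ℤ) * D)) ≡ 1 [ZMOD 8] := by
        have h2 : d ^ 2 ≡ 1 [ZMOD 8] := Int.sq_modEq_one_of_odd_s16 hd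
        refine Int.ModEq.trans ?_ h2
        rw [Int.modEq_iff_dvd]
        obtain ⟨k, hk⟩ := h.symm.dvd
        exact ⟨d * k, by linear_combination d * hk⟩
      obtain ⟨y, hy⟩ := Int.isSquare_padic_of_modEq_one hsq
      push_cast at hy
      refine ⟨y / d, 1, 0, by simp, ?_⟩
      push_cast
      field_simp
      linear_combination (y ^ 2 + q * D * d) * hy
end

section
/- Let ε = 1 and let d be a nonzero integer (positive or negative) with d ∣ pD. Then C′_d(ℚ_p) ≠ ∅ and C′_d(ℚ_q) ≠ ∅. -/
section FiniteFieldSquares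

variable {ℓ : ℕ} [Fact ℓ.Prime]

theorem ZMod.isSquare_mul_of_not_isSquare {x y : ZMod ℓ} (hx : ¬IsSquare x) (hy : ¬IsSquare y) :
    IsSquare (x * y) := by
  have hx0 : x ≠ 0 := by rintro rfl; exact hx IsSquare.zero
  have hy0 : y ≠ 0 := by rintro rfl; exact hy IsSquare.zero
  rw [← quadraticChar_one_iff_isSquare (mul_ne_zero hx0 hy0), map_mul,
    quadraticChar_neg_one_iff_not_isSquare.mpr hx, quadraticChar_neg_one_iff_not_isSquare.mpr hy]
  norm_num

theorem ZMod.exists_not_isSquare_sq_add (hℓ : ℓ ≠ 2) {a : ZMod ℓ} (ha : a ≠ 0) :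
    ∃ v : ZMod ℓ, ¬IsSquare (v ^ 2 + a) := by
  by_contra! h
  have hmul : ∀ k : ℕ, IsSquare ((k : ZMod ℓ) * a) := by
    intro k
    induction k with
    | zero => simp
    | succ k ih =>
      obtain ⟨r, hr⟩ := ih
      have := h r
      rwa [sq, ← hr, show (k : ZMod ℓ) * a + a = ((k + 1 : ℕ) : ZMod ℓ) * a by push_cast; ring]
        at this
  obtain ⟨x, hx⟩ := FiniteField.exists_nonsquare (F := ZMod ℓ) (by rwa [ZMod.ringChar_zmod_n])
  apply hx
  simpa [ha] using hmul (x / a).val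

theorem ZMod.two_ne_zero_of_ne_two (hℓ : ℓ ≠ 2) : (2 : ZMod ℓ) ≠ 0 :=
  Ring.two_ne_zero (by rwa [ZMod.ringChar_zmod_n])

theorem ZMod.exists_isSquare_mul_sq_add (hℓ : ℓ ≠ 2) {c d : ZMod ℓ} (hc : c ≠ 0) (hd : d ≠ 0)
    (h₁ : ¬IsSquare d) (h₂ : ¬IsSquare (-(c * d))) :
    ∃ u : ZMod ℓ, u ≠ 0 ∧ d * u ^ 2 + c ≠ 0 ∧ IsSquare (d * u ^ 2 + c) := by
  obtain ⟨y, hy⟩ := ZMod.exists_not_isSquare_sq_add hℓ (neg_ne_zero.mpr hc)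
  obtain ⟨t, ht⟩ := ZMod.isSquare_mul_of_not_isSquare h₁ hy
  have hyc : y ^ 2 + -c ≠ 0 := fun h ↦ hy (h ▸ IsSquare.zero)
  have key : d * (t / d) ^ 2 + c = y ^ 2 := by
    field_simp
    linear_combination -ht
  refine ⟨t / d, ?_, ?_, ?_⟩
  · refine div_ne_zero ?_ hd
    rintro rfl
    exact mul_ne_zero hd hyc (by simpa using ht)
  · rw [key]
    intro h
    apply h₂
    rw [h, zero_add] at ht
    exact ⟨t, by linear_combination ht⟩
  · rw [key]
    exact IsSquare.sq y

theorem ZMod.exists_isSquare_mul_add_sq (hℓ : ℓ ≠ 2) {a c : ZMod ℓ} (ha : a ≠ 0) (hc : c ≠ 0)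
    (h : ¬IsSquare (-a)) :
    ∃ v : ZMod ℓ, c * (v ^ 2 + a) ≠ 0 ∧ IsSquare (c * (v ^ 2 + a)) := by
  have hne (v : ZMod ℓ) : v ^ 2 + a ≠ 0 := fun hv ↦ h ⟨v, by linear_combination -hv⟩
  by_cases hcs : IsSquare c
  · have h2 := ZMod.two_ne_zero_of_ne_two hℓ
    refine ⟨(a - 1) / 2, mul_ne_zero hc (hne _), hcs.mul ⟨(a + 1) / 2, ?_⟩⟩
    field_simp
    ring
  · obtain ⟨v, hv⟩ := ZMod.exists_not_isSquare_sq_add hℓ ha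
    exact ⟨v, mul_ne_zero hc (hne _), ZMod.isSquare_mul_of_not_isSquare hcs hv⟩

end FiniteFieldSquares

section PadicPoints

variable {ℓ : ℕ} [Fact ℓ.Prime]

theorem Padic.isSquare_intCast_of_isSquare_zmod (hℓ : ℓ ≠ 2) {n : ℤ} (hn : (n : ZMod ℓ) ≠ 0)
    (h : IsSquare (n : ZMod ℓ)) : IsSquare (n : ℚ_[ℓ]) := by
  obtain ⟨x, hx⟩ := h
  obtain ⟨a, rfl⟩ := ZMod.intCast_surjective x
  have hdvd : (ℓ : ℤ) ∣ a ^ 2 - n := by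
    rw [← ZMod.intCast_zmod_eq_zero_iff_dvd]
    push_cast
    rw [hx]
    ring
  have h2a : ¬(ℓ : ℤ) ∣ 2 * a := by
    rw [← ZMod.intCast_zmod_eq_zero_iff_dvd]
    push_cast
    refine mul_ne_zero (ZMod.two_ne_zero_of_ne_two hℓ) ?_
    intro h0
    exact hn (by rw [hx, h0, zero_mul])
  let F : Polynomial ℤ_[ℓ] := Polynomial.X ^ 2 - Polynomial.C (n : ℤ_[ℓ])
  have hF (z : ℤ_[ℓ]) : F.aeval z = z ^ 2 - n := by simp [F]
  have hF' : F.derivative.aeval (a : ℤ_[ℓ]) = ((2 * a : ℤ) : ℤ_[ℓ]) := by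
    simp [F, one_add_one_eq_two]
  have hnorm' : ‖F.derivative.aeval (a : ℤ_[ℓ])‖ = 1 := by
    rw [hF']
    refine le_antisymm (PadicInt.norm_le_one _) (not_lt.mp ?_)
    rwa [PadicInt.norm_int_lt_one_iff_dvd]
  have hnorm : ‖F.aeval (a : ℤ_[ℓ])‖ < ‖F.derivative.aeval (a : ℤ_[ℓ])‖ ^ 2 := by
    rw [hnorm', hF, one_pow, show (a : ℤ_[ℓ]) ^ 2 - n = ((a ^ 2 - n : ℤ) : ℤ_[ℓ]) by push_cast; rfl]
    rwa [PadicInt.norm_int_lt_one_iff_dvd]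
  obtain ⟨z, hz, -⟩ := hensels_lemma hnorm
  rw [hF, sub_eq_zero] at hz
  refine ⟨z, ?_⟩
  rw [← sq]
  exact_mod_cast (congrArg ((↑) : ℤ_[ℓ] → ℚ_[ℓ]) hz).symm

theorem cd'Points_padic_of_not_dvd (hℓ : ℓ ≠ 2) {r D d : ℤ} (hr : (r : ZMod ℓ) ≠ 0)
    (hD : (D : ZMod ℓ) ≠ 0) (hd : (d : ZMod ℓ) ≠ 0) : Cd'Points ℚ_[ℓ] ℓ r D d := by
  have hd0 : (d : ℚ_[ℓ]) ≠ 0 := by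
    rw [Int.cast_ne_zero]
    rintro rfl
    simp at hd
  have hc : (r * D : ZMod ℓ) ≠ 0 := mul_ne_zero hr hD
  by_cases h₁ : IsSquare (d : ZMod ℓ)
  · obtain ⟨w, hw⟩ := Padic.isSquare_intCast_of_isSquare_zmod hℓ hd h₁
    refine ⟨1, 0, w, by simp, ?_⟩
    linear_combination -(d : ℚ_[ℓ]) * hw
  by_cases h₂ : IsSquare (-((r * D : ZMod ℓ) * d))
  · obtain ⟨s, hs⟩ := Padic.isSquare_intCast_of_isSquare_zmod (n := -(r * D * d)) hℓ
      (by push_cast; exact neg_ne_zero.mpr (mul_ne_zero hc hd)) (by push_cast; exact h₂)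
    push_cast at hs
    refine ⟨s, d, 0, by simp [hd0], ?_⟩
    push_cast
    linear_combination ((d : ℚ_[ℓ]) ^ 2 * (s ^ 2 + ℓ * D * d)) * hs
  obtain ⟨u, hu, hne, y, hy⟩ := ZMod.exists_isSquare_mul_sq_add hℓ hc hd h₁ h₂
  obtain ⟨u, rfl⟩ := ZMod.intCast_surjective u
  have hmod : ((d * (d * u ^ 2 + ℓ * D) * (d * u ^ 2 + r * D) : ℤ) : ZMod ℓ)
      = (d * u) ^ 2 * (d * u ^ 2 + r * D) := by
    push_cast
    rw [CharP.cast_eq_zero]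
    ring
  obtain ⟨s, hs⟩ := Padic.isSquare_intCast_of_isSquare_zmod hℓ
    (by rw [hmod]; exact mul_ne_zero (pow_ne_zero _ (mul_ne_zero hd hu)) hne)
    (by rw [hmod]; exact (IsSquare.sq _).mul ⟨y, hy⟩)
  refine ⟨u, 1, s / d, by simp, ?_⟩
  push_cast at hs ⊢
  field_simp
  linear_combination -hs

theorem cd'Points_padic_mul (hℓ : ℓ ≠ 2) {r D d : ℤ} (hr : (r : ZMod ℓ) ≠ 0)
    (hD : (D : ZMod ℓ) ≠ 0) (hd : (d : ZMod ℓ) ≠ 0) : Cd'Points ℚ_[ℓ] ℓ r D (ℓ * d) := by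
  have hd0 : (d : ℚ_[ℓ]) ≠ 0 := by
    rw [Int.cast_ne_zero]
    rintro rfl
    simp at hd
  have ha : (D * d : ZMod ℓ) ≠ 0 := mul_ne_zero hD hd
  by_cases h₁ : IsSquare (-(D * d : ZMod ℓ))
  · obtain ⟨s, hs⟩ := Padic.isSquare_intCast_of_isSquare_zmod (n := -(D * d)) hℓ
      (by push_cast; exact neg_ne_zero.mpr ha) (by push_cast; exact h₁)
    push_cast at hs
    refine ⟨s, d, 0, by simp [hd0], ?_⟩
    push_cast
    linear_combination ((ℓ : ℚ_[ℓ]) * d ^ 2 * (ℓ * s ^ 2 + r * D * d)) * hs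
  obtain ⟨v, hne, hsq⟩ := ZMod.exists_isSquare_mul_add_sq hℓ ha (mul_ne_zero hr hD) h₁
  obtain ⟨u, hu⟩ := ZMod.intCast_surjective (v / (d : ZMod ℓ))
  have hv : v = d * u := by rw [hu]; field_simp
  subst hv
  have hmod : ((d * (d * u ^ 2 + D) * (ℓ * d * u ^ 2 + r * D) : ℤ) : ZMod ℓ)
      = r * D * ((d * u) ^ 2 + D * d) := by
    push_cast
    rw [CharP.cast_eq_zero]
    ring
  obtain ⟨s, hs⟩ := Padic.isSquare_intCast_of_isSquare_zmod hℓ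
    (by rw [hmod]; exact hne) (by rw [hmod]; exact hsq)
  refine ⟨u, 1, s / d, by simp, ?_⟩
  push_cast at hs ⊢
  field_simp
  linear_combination -(ℓ : ℚ_[ℓ]) * hs

theorem cd'Points_comm {K : Type} [Field K] {p q D d : ℤ} (h : Cd'Points K p q D d) :
    Cd'Points K q p D d := by
  obtain ⟨u, z, w, hne, h⟩ := h
  exact ⟨u, z, w, hne, by linear_combination h⟩

end PadicPoints

theorem stmt17
    (m : ℕ) (hm : 1 ≤ m)
    (p q : ℕ) (hp : p.Prime) (hq : q.Prime) (hpodd : Odd p) (hqodd : Odd q)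
    (hpq : (q : ℤ) - (p : ℤ) = 2 ^ m)
    (D : ℤ) (hD0 : 0 < D) (hDsf : Squarefree D) (hDodd : Odd D)
    (hpD : ¬((p : ℤ) ∣ D)) (hqD : ¬((q : ℤ) ∣ D))
    (d : ℤ) (hd0 : d ≠ 0) (hdD : d ∣ (p : ℤ) * D) :
    (letI : Fact p.Prime := ⟨hp⟩;
      Cd'Points ℚ_[p] (p : ℤ) (q : ℤ) D d) ∧
    (letI : Fact q.Prime := ⟨hq⟩;
      Cd'Points ℚ_[q] (p : ℤ) (q : ℤ) D d) := by
  have hp2 : p ≠ 2 := by rintro rfl; exact absurd hpodd (by decide)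
  have hq2 : q ≠ 2 := by rintro rfl; exact absurd hqodd (by decide)
  have hlt : p < q := by
    have : (0 : ℤ) < 2 ^ m := by positivity
    omega
  have hpq' : ¬(p : ℤ) ∣ q := by
    rw [Int.natCast_dvd_natCast, Nat.prime_dvd_prime_iff_eq hp hq]
    exact hlt.ne
  have hqp' : ¬(q : ℤ) ∣ p := by
    rw [Int.natCast_dvd_natCast, Nat.prime_dvd_prime_iff_eq hq hp]
    exact hlt.ne'
  have hcast {ℓ : ℕ} {n : ℤ} (h : ¬(ℓ : ℤ) ∣ n) : (n : ZMod ℓ) ≠ 0 := by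
    rwa [Ne, ZMod.intCast_zmod_eq_zero_iff_dvd]
  constructor
  · have : Fact p.Prime := ⟨hp⟩
    by_cases hpd : (p : ℤ) ∣ d
    · obtain ⟨e, rfl⟩ := hpd
      have he : e ∣ D := Int.dvd_of_mul_dvd_mul_left (by exact_mod_cast hp.ne_zero) hdD
      exact cd'Points_padic_mul hp2 (hcast hpq') (hcast hpD) (hcast fun h ↦ hpD (h.trans he))
    · exact cd'Points_padic_of_not_dvd hp2 (hcast hpq') (hcast hpD) (hcast hpd)
  · have : Fact q.Prime := ⟨hq⟩
    have hqd : ¬(q : ℤ) ∣ d := fun h ↦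
      ((Nat.prime_iff_prime_int.mp hq).dvd_or_dvd (h.trans hdD)).elim hqp' hqD
    exact cd'Points_comm (cd'Points_padic_of_not_dvd hq2 (hcast hqp') (hcast hqD) (hcast hqd))
end

section
/- Let ε = 1 and let d be a nonzero integer (positive or negative) with d ∣ pD. For every prime l dividing D with l ∤ d, one has C′_d(ℚ_l) ≠ ∅ if and only if (1 − (d/l))(1 − (pqd/l)) = 0, i.e. the Legendre symbol (d/l) equals 1 or the Legendre symbol (pqd/l) equals 1. -/
theorem legendreSym_eq_one_iff_exists_sq {l : ℕ} [Fact l.Prime] {a : ℤ} (ha : ¬(l : ℤ) ∣ a) :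
    legendreSym l a = 1 ↔ ∃ x : ZMod l, x ^ 2 = (a : ZMod l) := by
  have h0 : (a : ZMod l) ≠ 0 := by rwa [Ne, ZMod.intCast_zmod_eq_zero_iff_dvd a l]
  rw [legendreSym.eq_one_iff l h0, isSquare_iff_exists_sq]
  exact exists_congr fun x => eq_comm

theorem PadicInt.toZMod_eq_zero_iff_norm_lt_one {l : ℕ} [Fact l.Prime] (x : ℤ_[l]) :
    PadicInt.toZMod x = 0 ↔ ‖x‖ < 1 := by
  rw [← RingHom.mem_ker, PadicInt.ker_toZMod, IsLocalRing.mem_maximalIdeal, PadicInt.mem_nonunits]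

/-- An integer that is a nonzero square modulo an odd prime `l` is a square in `ℚ_[l]`. -/
theorem Padic.exists_sq_eq_of_legendreSym_eq_one {l : ℕ} [Fact l.Prime] (hl : l ≠ 2) {a : ℤ}
    (ha : ¬(l : ℤ) ∣ a) (h : legendreSym l a = 1) : ∃ x : ℚ_[l], x ^ 2 = a := by
  obtain ⟨y, hy⟩ := (legendreSym_eq_one_iff_exists_sq ha).1 h
  obtain ⟨b, rfl⟩ := ZMod.ringHom_surjective (PadicInt.toZMod (p := l)) y
  have h2 : ((2 : ℕ) : ZMod l) ≠ 0 := by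
    rw [Ne, ZMod.natCast_eq_zero_iff]
    exact fun h => hl ((Nat.prime_dvd_prime_iff_eq Fact.out Nat.prime_two).1 h)
  have hb : PadicInt.toZMod b ≠ 0 := by
    intro h0
    rw [h0, zero_pow two_ne_zero, eq_comm, ZMod.intCast_zmod_eq_zero_iff_dvd] at hy
    exact ha hy
  have hunit : ‖2 * b‖ = 1 := by
    refine le_antisymm (PadicInt.norm_le_one _) (not_lt.1 fun hlt => ?_)
    rw [← PadicInt.toZMod_eq_zero_iff_norm_lt_one, map_mul] at hlt
    rcases mul_eq_zero.1 hlt with h | h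
    · exact h2 (by rw [map_ofNat] at h; exact_mod_cast h)
    · exact hb h
  have hsmall : ‖b ^ 2 - a‖ < 1 := by
    rw [← PadicInt.toZMod_eq_zero_iff_norm_lt_one]
    simp [hy]
  obtain ⟨z, hz, -⟩ := hensels_lemma (p := l) (R := ℤ_[l])
    (F := Polynomial.X ^ 2 - Polynomial.C (a : ℤ_[l])) (a := b) (by
      have hder : ‖(2 : ℤ_[l])‖ * ‖b‖ = 1 := by rw [← norm_mul, hunit]
      simpa [Polynomial.derivative_X_pow, one_add_one_eq_two, hder] using hsmall)
  refine ⟨z, ?_⟩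
  have : z ^ 2 = (a : ℤ_[l]) := by simpa [sub_eq_zero] using hz
  exact_mod_cast congrArg (fun t : ℤ_[l] => (t : ℚ_[l])) this

theorem legendreSym_eq_one_of_padic_sq_eq_add {l : ℕ} [Fact l.Prime] {c : ℤ}
    (hc : ¬(l : ℤ) ∣ c) {w : ℚ_[l]} {x : ℤ_[l]} (h : w ^ 2 = c + l * x) :
    legendreSym l c = 1 := by
  have hcx : ((c + l * x : ℤ_[l]) : ℚ_[l]) = c + l * x := by push_cast; rfl
  have hw : ‖w‖ ≤ 1 := by
    have h1 : ‖w‖ ^ 2 ≤ 1 := by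
      rw [← norm_pow, h, ← hcx]
      exact PadicInt.norm_le_one _
    exact (sq_le_one_iff₀ (norm_nonneg w)).1 h1
  let W : ℤ_[l] := ⟨w, hw⟩
  have h2 : W ^ 2 = c + l * x := by
    apply Subtype.ext
    rw [hcx, ← h]
    rfl
  refine (legendreSym_eq_one_iff_exists_sq hc).2 ⟨PadicInt.toZMod W, ?_⟩
  rw [← map_pow, h2]
  simp

theorem Padic.exists_eq_natCast_mul_of_norm_lt_one {l : ℕ} [Fact l.Prime] {s : ℚ_[l]}
    (hs : ‖s‖ < 1) : ∃ r : ℤ_[l], s = l * r := by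
  obtain ⟨r, hr⟩ := (PadicInt.norm_lt_one_iff_dvd (⟨s, hs.le⟩ : ℤ_[l])).1 hs
  exact ⟨r, by simpa using congrArg (fun t : ℤ_[l] => (t : ℚ_[l])) hr⟩

theorem legendreSym_mul_sq {l : ℕ} [Fact l.Prime] {a b : ℤ} (hb : ¬(l : ℤ) ∣ b) :
    legendreSym l (a * b ^ 2) = legendreSym l a := by
  have h0 : (b : ZMod l) ≠ 0 := by rwa [Ne, ZMod.intCast_zmod_eq_zero_iff_dvd b l]
  rw [legendreSym.mul, legendreSym.sq_one' l h0, mul_one]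

theorem legendreSym_eq_one_or_of_Cd'Points {l : ℕ} [Fact l.Prime] {p q D d : ℤ}
    (hD : ¬(l : ℤ) ∣ D) (hp : ¬(l : ℤ) ∣ p) (hq : ¬(l : ℤ) ∣ q) (hd : ¬(l : ℤ) ∣ d)
    (h : Cd'Points ℚ_[l] p q (l * D) d) :
    legendreSym l d = 1 ∨ legendreSym l (p * q * d) = 1 := by
  have hl : Prime (l : ℤ) := Nat.prime_iff_prime_int.1 Fact.out
  have hl0 : (l : ℚ_[l]) ≠ 0 := Nat.cast_ne_zero.2 (Fact.out : l.Prime).ne_zero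
  obtain ⟨u, z, w, hne, h⟩ := h
  push_cast at h
  rcases le_or_gt ‖z‖ ‖u‖ with hzu | huz
  · left
    have hu : u ≠ 0 := by
      rintro rfl
      exact hne ⟨rfl, by simpa using hzu⟩
    obtain ⟨t, ht⟩ : ∃ t : ℤ_[l], z = t * u := by
      refine ⟨⟨z / u, ?_⟩, (div_mul_cancel₀ z hu).symm⟩
      rw [norm_div]
      exact div_le_one_of_le₀ hzu (norm_nonneg u)
    rw [← legendreSym_mul_sq hd]
    refine legendreSym_eq_one_of_padic_sq_eq_add (w := d * (w / u ^ 2))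
      (x := d * ((p + q) * D * d * t ^ 2 + p * q * l * D ^ 2 * t ^ 4)) ?_ ?_
    · exact fun hdvd => (hl.dvd_or_dvd hdvd).elim hd fun h => hd (hl.dvd_of_dvd_pow h)
    · subst ht
      push_cast
      field_simp
      linear_combination d * h
  · right
    have hz : z ≠ 0 := by
      rintro rfl
      exact (norm_nonneg u).not_gt (by simpa using huz)
    obtain ⟨r, hr⟩ : ∃ r : ℤ_[l], u / z = l * r := by
      refine Padic.exists_eq_natCast_mul_of_norm_lt_one ?_
      rw [norm_div]
      exact (div_lt_one ((norm_nonneg u).trans_lt huz)).2 huz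
    rw [div_eq_iff hz] at hr
    rw [← legendreSym_mul_sq hD]
    refine legendreSym_eq_one_of_padic_sq_eq_add (w := d * (w / (l * z ^ 2)))
      (x := d * ((p + q) * D * d * r ^ 2 + d ^ 2 * l * r ^ 4)) ?_ ?_
    · intro hdvd
      simp only [hl.dvd_mul, hl.dvd_pow_iff_dvd two_ne_zero] at hdvd
      tauto
    · subst hr
      push_cast
      field_simp
      linear_combination d * h

theorem Cd'Points_of_exists_sq_eq {K : Type} [Field K] {p q D d : ℤ}
    (h : ∃ x : K, x ^ 2 = d) : Cd'Points K p q D d := by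
  obtain ⟨x, hx⟩ := h
  exact ⟨1, 0, x, by simp, by linear_combination d * hx⟩

theorem Cd'Points_of_exists_sq_eq_mul {K : Type} [Field K] {p q D d : ℤ} (hd : (d : K) ≠ 0)
    (h : ∃ x : K, x ^ 2 = (p * q * d : ℤ)) : Cd'Points K p q D d := by
  obtain ⟨x, hx⟩ := h
  refine ⟨0, 1, D * x / d, by simp, ?_⟩
  push_cast at hx
  field_simp
  linear_combination D ^ 2 * hx

theorem stmt18
    (m : ℕ) (hm : 1 ≤ m)
    (p q : ℕ) (hp : p.Prime) (hq : q.Prime) (hpodd : Odd p) (hqodd : Odd q)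
    (hpq : (q : ℤ) - (p : ℤ) = 2 ^ m)
    (D : ℤ) (hD0 : 0 < D) (hDsf : Squarefree D) (hDodd : Odd D)
    (hpD : ¬((p : ℤ) ∣ D)) (hqD : ¬((q : ℤ) ∣ D))
    (d : ℤ) (hd0 : d ≠ 0) (hdD : d ∣ (p : ℤ) * D) :
    ∀ l : ℕ, ∀ hl : l.Prime, (l : ℤ) ∣ D → ¬((l : ℤ) ∣ d) →
      (letI : Fact l.Prime := ⟨hl⟩;
        (Cd'Points ℚ_[l] (p : ℤ) (q : ℤ) D d ↔
          (legendreSym l d = 1 ∨ legendreSym l ((p : ℤ) * (q : ℤ) * d) = 1))) := by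
  intro l hl hlD hld
  have : Fact l.Prime := ⟨hl⟩
  have hlint : Prime (l : ℤ) := Nat.prime_iff_prime_int.1 hl
  have hl2 : l ≠ 2 := by
    rintro rfl
    exact Int.not_even_iff_odd.2 hDodd (even_iff_two_dvd.2 hlD)
  have not_dvd : ∀ r : ℕ, r.Prime → ¬(r : ℤ) ∣ D → ¬(l : ℤ) ∣ r := fun r hr hrD h =>
    hrD ((Nat.prime_dvd_prime_iff_eq hl hr).1 (Int.natCast_dvd_natCast.1 h) ▸ hlD)
  have hlp := not_dvd p hp hpD
  have hlq := not_dvd q hq hqD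
  constructor
  · obtain ⟨E, rfl⟩ := hlD
    refine legendreSym_eq_one_or_of_Cd'Points (fun hE => ?_) hlp hlq hld
    exact hlint.not_isUnit (hDsf l (mul_dvd_mul_left _ hE))
  · rintro (h | h)
    · exact Cd'Points_of_exists_sq_eq (Padic.exists_sq_eq_of_legendreSym_eq_one hl2 hld h)
    · refine Cd'Points_of_exists_sq_eq_mul (Int.cast_ne_zero.2 hd0)
        (Padic.exists_sq_eq_of_legendreSym_eq_one hl2 ?_ h)
      simp only [hlint.dvd_mul]
      tauto
end
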